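/- arXiv:math/0310432 — 2 statements merged into one kernel-verified Lean document; each statement's English description precedes it below -/
import Mathlib

section
/- For all real numbers a and b, the double integral ∫₀^{2π} ∫₀^{2π} |a·cos φ·cos ψ + b·sin φ·sin ψ| dφ dψ equals 4 · ∫₀^{2π} √(a²·cos²φ + b²·sin²φ) dφ. -/
open Real intervalIntegral

theorem integral_abs_sin_zero_two_pi : ∫ x in (0:ℝ)..(2 * π), |Real.sin x| = 4 := by
  have hint : ∀ s t : ℝ, IntervalIntegrable (fun x => |Real.sin x|) MeasureTheory.volume s t :=
    fun s t => Real.continuous_sin.abs.intervalIntegrable s t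
  have hper : Function.Periodic (fun x => |Real.sin x|) π := fun x => by
    simp [Real.sin_add_pi]
  have hhalf : ∫ x in (0:ℝ)..π, |Real.sin x| = 2 := by
    have h_sin : ∫ x in (0:ℝ)..π, Real.sin x = 2 := by
      rw [integral_sin, Real.cos_zero, Real.cos_pi]
      norm_num
    rw [← h_sin]
    refine integral_congr fun x hx => ?_
    rw [Set.uIcc_of_le Real.pi_pos.le] at hx
    exact abs_of_nonneg (Real.sin_nonneg_of_mem_Icc hx)
  have h := hper.intervalIntegral_add_eq_add 0 π hint
  rw [zero_add, hhalf, ← two_mul] at h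
  rw [h]
  norm_num

theorem integral_abs_cos_add_sin (A B : ℝ) :
    ∫ x in (0:ℝ)..(2 * π), |A * Real.cos x + B * Real.sin x| = 4 * √(A ^ 2 + B ^ 2) := by
  set z : ℂ := ⟨B, A⟩
  have hz : ‖z‖ = √(A ^ 2 + B ^ 2) := by
    rw [Complex.norm_def, Complex.normSq_mk]
    congr 1
    ring
  have hA : ‖z‖ * Real.sin z.arg = A := Complex.norm_mul_sin_arg z
  have hB : ‖z‖ * Real.cos z.arg = B := Complex.norm_mul_cos_arg z
  have hphase : ∀ x, |A * Real.cos x + B * Real.sin x| = ‖z‖ * |Real.sin (x + z.arg)| := by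
    intro x
    rw [← abs_of_nonneg (norm_nonneg z), ← abs_mul,
      Real.sin_add, ← hA, ← hB]
    ring_nf
  have hper : Function.Periodic (fun x => |Real.sin x|) (2 * π) := fun x => by
    simp [Real.sin_add_two_pi]
  have hshift := hper.intervalIntegral_add_eq z.arg 0
  rw [zero_add, integral_abs_sin_zero_two_pi] at hshift
  simp_rw [hphase]
  rw [integral_const_mul, integral_comp_add_right (fun x => |Real.sin x|), zero_add,
    add_comm (2 * π), hshift, hz, mul_comm]

theorem double_integral_abs_eq_four_ellipse (a b : ℝ) :
    (∫ ψ in (0:ℝ)..(2 * π), ∫ φ in (0:ℝ)..(2 * π),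
      |a * Real.cos φ * Real.cos ψ + b * Real.sin φ * Real.sin ψ|) =
    4 * ∫ φ in (0:ℝ)..(2 * π),
      Real.sqrt (a ^ 2 * Real.cos φ ^ 2 + b ^ 2 * Real.sin φ ^ 2) := by
  rw [← integral_const_mul]
  refine integral_congr fun ψ _ => ?_
  simpa only [mul_right_comm, mul_pow] using
    integral_abs_cos_add_sin (a * Real.cos ψ) (b * Real.sin ψ)
end

section
/- For every real number θ, ∫₀^{2π} ∫₀^{2π} |cos φ·cos ψ·cos²θ + sin φ·sin ψ·sin²θ| dφ dψ = 4 · ∫₀^{2π} √(cos⁴θ·cos²φ + sin⁴θ·sin²φ) dφ. -/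
open Real intervalIntegral

theorem integral_abs_cos_two_pi : ∫ x in (0:ℝ)..(2 * π), |Real.cos x| = 4 := by
  have hper : Function.Periodic (fun x : ℝ => |Real.cos x|) (2 * π) := fun x => by
    simp [Real.cos_add_two_pi]
  have hint : ∀ a b : ℝ, IntervalIntegrable (fun x : ℝ => |Real.cos x|) MeasureTheory.volume a b :=
    fun a b => Real.continuous_cos.abs.intervalIntegrable a b
  have hshift := hper.intervalIntegral_add_eq 0 (-(π / 2))
  rw [zero_add] at hshift
  rw [hshift, ← integral_add_adjacent_intervals (hint _ (π / 2)) (hint _ _)]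
  have hpos : ∫ x in (-(π / 2))..(π / 2), |Real.cos x| = 2 := by
    have h : ∫ x in (-(π / 2))..(π / 2), |Real.cos x| = ∫ x in (-(π / 2))..(π / 2), Real.cos x := by
      refine integral_congr fun x hx => ?_
      rw [Set.uIcc_of_le (by linarith [pi_pos])] at hx
      exact abs_of_nonneg (cos_nonneg_of_mem_Icc hx)
    rw [h, integral_cos, Real.sin_neg, sin_pi_div_two]
    norm_num
  have hneg : ∫ x in (π / 2)..(-(π / 2) + 2 * π), |Real.cos x| = 2 := by
    refine Eq.trans ?_ hpos
    have h := integral_comp_add_right (a := -(π / 2)) (b := π / 2) (fun x => |Real.cos x|) π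
    simp only [Real.cos_add_pi, abs_neg] at h
    rw [h]
    congr 1 <;> ring
  rw [hpos, hneg]
  norm_num

theorem integral_abs_mul_cos_add_mul_sin (a b : ℝ) :
    ∫ x in (0:ℝ)..(2 * π), |a * Real.cos x + b * Real.sin x| = 4 * √(a ^ 2 + b ^ 2) := by
  set z : ℂ := ⟨a, b⟩
  have hz : ‖z‖ = √(a ^ 2 + b ^ 2) := by
    rw [Complex.norm_def, Complex.normSq_apply, ← sq, ← sq]
  have ha : ‖z‖ * Real.cos z.arg = a := Complex.norm_mul_cos_arg z
  have hb : ‖z‖ * Real.sin z.arg = b := Complex.norm_mul_sin_arg z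
  have h (x : ℝ) : |a * Real.cos x + b * Real.sin x| = ‖z‖ * |Real.cos (x - z.arg)| := by
    rw [← abs_of_nonneg (norm_nonneg z), ← abs_mul, Real.cos_sub]
    congr 1
    linear_combination -Real.cos x * ha - Real.sin x * hb
  have hper : Function.Periodic (fun x : ℝ => |Real.cos x|) (2 * π) := fun x => by
    simp [Real.cos_add_two_pi]
  have hshift := hper.intervalIntegral_add_eq (0 - z.arg) 0
  rw [zero_add, integral_abs_cos_two_pi] at hshift
  simp_rw [h]
  rw [integral_const_mul, integral_comp_sub_right (fun x => |Real.cos x|), ← hz,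
    show 2 * π - z.arg = 0 - z.arg + 2 * π by ring, hshift, mul_comm]

theorem double_integral_abs_eq_four_ellipse_theta (θ : ℝ) :
    (∫ ψ in (0:ℝ)..(2 * π), ∫ φ in (0:ℝ)..(2 * π),
      |Real.cos φ * Real.cos ψ * Real.cos θ ^ 2 +
        Real.sin φ * Real.sin ψ * Real.sin θ ^ 2|) =
    4 * ∫ φ in (0:ℝ)..(2 * π),
      Real.sqrt (Real.cos θ ^ 4 * Real.cos φ ^ 2 +
        Real.sin θ ^ 4 * Real.sin φ ^ 2) := by
  rw [← integral_const_mul]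
  congr 1 with ψ
  have h := integral_abs_mul_cos_add_mul_sin
    (Real.cos ψ * Real.cos θ ^ 2) (Real.sin ψ * Real.sin θ ^ 2)
  convert h using 4 <;> ring_nf
end
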